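/- Let τ lie in the complex upper half-plane. Then (v(τ)² + 1)²·𝔟(4τ)² = 4·(v(τ)⁴ − 6·v(τ)² + 1); equivalently, (v²(τ)+1)²/(v⁴(τ)−6v²(τ)+1) = 4/𝔟²(4τ) whenever the denominators are nonzero. -/

import Mathlib

/-- `qpow τ r = exp(2πi·r·τ)`, i.e. `q^r` where `q = exp(2πiτ)`. -/
noncomputable def qpow (τ : ℂ) (r : ℝ) : ℂ :=
  Complex.exp (2 * (Real.pi : ℂ) * Complex.I * (r : ℂ) * τ)

/-- The Kronecker symbol `(2/n)`: `+1` if `n ≡ ±1 (mod 8)`, `-1` if `n ≡ ±3 (mod 8)`,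
`0` if `n` is even. -/
def chi8 (n : ℕ) : ℤ :=
  if n % 8 = 1 ∨ n % 8 = 7 then 1 else if n % 8 = 3 ∨ n % 8 = 5 then -1 else 0

/-- Ramanujan's continued fraction value
`v(τ) = q^{1/2} ∏_{n≥1} (1 - q^n)^{χ₈(n)}`, `q = exp(2πiτ)`. -/
noncomputable def vRam (τ : ℂ) : ℂ :=
  qpow τ (1/2) * ∏' n : ℕ, (1 - qpow τ ((n : ℝ) + 1)) ^ chi8 (n + 1)

/-- `𝔟(τ) = 2 ∏_{n≥1} ((1 - q^{n/2 - 1/4})/(1 + q^{n/2 - 1/4}))²`. -/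
noncomputable def bWeb (τ : ℂ) : ℂ :=
  2 * ∏' n : ℕ,
    ((1 - qpow τ (((n : ℝ) + 1) / 2 - 1/4)) / (1 + qpow τ (((n : ℝ) + 1) / 2 - 1/4))) ^ 2

open Filter Topology

/-- The infinite `q`-Pochhammer symbol `(a; q)_∞`. -/
noncomputable def qPochInf (a q : ℂ) : ℂ := ∏' n : ℕ, (1 - a * q ^ n)

/-- The theta series `∑_{j ∈ ℤ} x^{j²} z^j`. -/
noncomputable def thetaSeries (x z : ℂ) : ℂ := ∑' j : ℤ, x ^ (j ^ 2) * z ^ j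

/-- The reciprocal of the `q`-Pochhammer symbol `(y; y)_m`, extended by zero to negative `m`. -/
noncomputable def invQPoch (y : ℂ) (m : ℤ) : ℂ :=
  if m < 0 then 0 else (∏ k ∈ Finset.range m.toNat, (1 - y ^ (k + 1)))⁻¹

lemma one_sub_ne_zero_of_norm_lt_one {a : ℂ} (ha : ‖a‖ < 1) : 1 - a ≠ 0 := by
  intro h
  rw [← sub_eq_zero.mp h] at ha
  simp at ha

lemma summable_norm_mul_pow (a : ℂ) {q : ℂ} (hq : ‖q‖ < 1) :
    Summable fun n : ℕ ↦ ‖-(a * q ^ n)‖ := by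
  simpa [norm_mul, norm_pow] using
    (summable_geometric_of_lt_one (norm_nonneg q) hq).mul_left ‖a‖

lemma multipliable_one_sub_mul_pow (a : ℂ) {q : ℂ} (hq : ‖q‖ < 1) :
    Multipliable fun n : ℕ ↦ 1 - a * q ^ n := by
  simpa [sub_eq_add_neg] using multipliable_one_add_of_summable (summable_norm_mul_pow a hq)

lemma hasProd_qPochInf (a : ℂ) {q : ℂ} (hq : ‖q‖ < 1) :
    HasProd (fun n : ℕ ↦ 1 - a * q ^ n) (qPochInf a q) :=
  (multipliable_one_sub_mul_pow a hq).hasProd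

lemma qPochInf_ne_zero {a q : ℂ} (hq : ‖q‖ < 1) (ha : ‖a‖ < 1) : qPochInf a q ≠ 0 := by
  have := tprod_one_add_ne_zero_of_summable (f := fun n : ℕ ↦ -(a * q ^ n)) (fun n ↦ ?_)
    (summable_norm_mul_pow a hq)
  · simpa [qPochInf, sub_eq_add_neg] using this
  · rw [← sub_eq_add_neg]
    apply one_sub_ne_zero_of_norm_lt_one
    rw [norm_mul, norm_pow]
    exact (mul_le_of_le_one_right (norm_nonneg a)
      (pow_le_one₀ (norm_nonneg q) hq.le)).trans_lt ha

lemma norm_pow_lt_one {q : ℂ} (hq : ‖q‖ < 1) {k : ℕ} (hk : k ≠ 0) : ‖q ^ k‖ < 1 := by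
  rw [norm_pow]
  exact pow_lt_one₀ (norm_nonneg q) hq hk

lemma qPochInf_mul_neg (a : ℂ) {q : ℂ} (hq : ‖q‖ < 1) :
    qPochInf a q * qPochInf (-a) q = qPochInf (a ^ 2) (q ^ 2) := by
  rw [qPochInf, qPochInf, ← (multipliable_one_sub_mul_pow a hq).tprod_mul
    (multipliable_one_sub_mul_pow (-a) hq), qPochInf]
  exact tprod_congr fun n ↦ by ring

lemma qPochInf_split (a : ℂ) {q : ℂ} (hq : ‖q‖ < 1) :
    qPochInf a q = qPochInf a (q ^ 2) * qPochInf (a * q) (q ^ 2) := by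
  have hq2 := norm_pow_lt_one hq two_ne_zero
  refine ((hasProd_qPochInf a hq).unique (HasProd.even_mul_odd ?_ ?_))
  · simpa [pow_mul] using hasProd_qPochInf a hq2
  · convert hasProd_qPochInf (a * q) hq2 using 2
    ring

lemma qPochInf_eq_mul (a : ℂ) {q : ℂ} (hq : ‖q‖ < 1) :
    qPochInf a q = (1 - a) * qPochInf (a * q) q := by
  refine (hasProd_qPochInf a hq).unique ?_
  simpa using HasProd.zero_mul (f := fun n : ℕ ↦ 1 - a * q ^ n) (m := qPochInf (a * q) q)
    (by convert hasProd_qPochInf (a * q) hq using 2; ring)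

lemma qPoch_ne_zero {y : ℂ} (hy : ‖y‖ < 1) (m : ℕ) :
    ∏ k ∈ Finset.range m, (1 - y ^ (k + 1)) ≠ 0 :=
  Finset.prod_ne_zero_iff.mpr fun k _ ↦
    one_sub_ne_zero_of_norm_lt_one (norm_pow_lt_one hy k.succ_ne_zero)

lemma invQPoch_eq_mul_succ {y : ℂ} (hy : ‖y‖ < 1) (m : ℤ) :
    invQPoch y m = (1 - y ^ (m + 1)) * invQPoch y (m + 1) := by
  rcases lt_trichotomy m (-1) with h | rfl | h
  · simp [invQPoch, show m < 0 by omega, show m + 1 < 0 by omega]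
  · simp [invQPoch]
  · lift m to ℕ using by omega
    have h1 : ¬ ((m : ℤ) + 1 < 0) := by omega
    have h2 : ((m : ℤ) + 1).toNat = m + 1 := by omega
    have h3 := one_sub_ne_zero_of_norm_lt_one (norm_pow_lt_one hy m.succ_ne_zero)
    have h4 := qPoch_ne_zero hy m
    have h5 : y ^ ((m : ℤ) + 1) = y ^ (m + 1) := by exact_mod_cast zpow_natCast y (m + 1)
    simp only [invQPoch, h1, h2, h5, Finset.prod_range_succ, Int.toNat_natCast, if_false,
      show ¬ ((m : ℤ) < 0) by omega, Nat.succ_eq_add_one] at *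
    field_simp

/-- The finite form of Jacobi's triple product identity. -/
lemma hasSum_finite_triple_product {x z : ℂ} (hx : ‖x‖ < 1) (hx0 : x ≠ 0) (hz : z ≠ 0) (n : ℕ) :
    HasSum (fun j : ℤ ↦ (∏ k ∈ Finset.range (2 * n), (1 - (x ^ 2) ^ (k + 1))) *
        (invQPoch (x ^ 2) (n + j) * invQPoch (x ^ 2) (n - j)) * (x ^ (j ^ 2) * z ^ j))
      (∏ k ∈ Finset.range n, ((1 + x ^ (2 * k + 1) * z) * (1 + x ^ (2 * k + 1) * z⁻¹))) := by
  have hy := norm_pow_lt_one hx two_ne_zero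
  induction n with
  | zero =>
    convert hasSum_single (0 : ℤ) fun j hj ↦ ?_ using 1
    · simp [invQPoch]
    · rcases lt_or_gt_of_ne hj with h | h
      · simp [invQPoch, h]
      · simp [invQPoch, h]
  | succ n ih =>
    have h1 := (Equiv.subRight (1 : ℤ)).hasSum_iff.mpr ih
    have h2 := (Equiv.addRight (1 : ℤ)).hasSum_iff.mpr ih
    have h := ((ih.mul_left (1 + x ^ (4 * n + 2))).add (h1.mul_left (x ^ (2 * n + 1) * z))).add
      (h2.mul_left (x ^ (2 * n + 1) * z⁻¹))
    have hsum : ∀ S : ℂ, (1 + x ^ (4 * n + 2)) * S + x ^ (2 * n + 1) * z * S +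
        x ^ (2 * n + 1) * z⁻¹ * S =
        S * ((1 + x ^ (2 * n + 1) * z) * (1 + x ^ (2 * n + 1) * z⁻¹)) := fun S ↦ by
      field_simp
      ring
    rw [Finset.prod_range_succ, ← hsum]
    refine Eq.mpr (congrArg (HasSum · _) (funext fun j ↦ ?_)) h
    simp only [Function.comp_apply, Equiv.subRight_apply, Equiv.coe_addRight]
    rw [show 2 * (n + 1) = 2 * n + 1 + 1 by ring, Finset.prod_range_succ, Finset.prod_range_succ]
    have e1 := invQPoch_eq_mul_succ hy (n + (j - 1))
    have e2 := invQPoch_eq_mul_succ hy (n + j)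
    have e3 := invQPoch_eq_mul_succ hy (n - (j + 1))
    have e4 := invQPoch_eq_mul_succ hy (n - j)
    rw [show (n : ℤ) + (j - 1) + 1 = n + j by ring] at e1
    rw [show (n : ℤ) - (j + 1) + 1 = n - j by ring] at e3
    rw [show ((n + 1 : ℕ) : ℤ) + j = n + j + 1 by push_cast; ring,
      show ((n + 1 : ℕ) : ℤ) - j = n - j + 1 by push_cast; ring,
      show (n : ℤ) + (j + 1) = n + j + 1 by ring,
      show (n : ℤ) - (j - 1) = n - j + 1 by ring, e1, e3, e2, e4]
    have hX : ∀ m : ℤ, (x ^ 2) ^ m = (x ^ m) ^ 2 := fun m ↦ by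
      rw [← zpow_natCast, ← zpow_natCast, ← zpow_mul, ← zpow_mul, mul_comm]
    have hm : x ^ ((j - 1) ^ 2) = x ^ (j ^ 2) * x / (x ^ j) ^ 2 := by
      rw [show (j - 1) ^ 2 = j ^ 2 + 1 - (j + j) by ring, zpow_sub₀ hx0, zpow_add₀ hx0,
        zpow_add₀ hx0]
      simp [sq]
    have hp : x ^ ((j + 1) ^ 2) = x ^ (j ^ 2) * x * (x ^ j) ^ 2 := by
      rw [show (j + 1) ^ 2 = j ^ 2 + 1 + (j + j) by ring, zpow_add₀ hx0, zpow_add₀ hx0,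
        zpow_add₀ hx0]
      simp [sq]
    rw [hm, hp]
    simp only [hX, zpow_add₀ hx0, zpow_sub₀ hx0, zpow_add₀ hz, zpow_sub₀ hz, zpow_natCast,
      zpow_one]
    have hj : x ^ j ≠ 0 := zpow_ne_zero _ hx0
    generalize invQPoch (x ^ 2) (n + j + 1) = A
    generalize invQPoch (x ^ 2) (n - j + 1) = B
    generalize ∏ k ∈ Finset.range (2 * n), (1 - (x ^ 2) ^ (k + 1)) = C
    generalize x ^ (j ^ 2) = D
    generalize z ^ j = E
    generalize x ^ j = J at *
    rw [show x ^ (4 * n + 2) = (x ^ n) ^ 4 * x ^ 2 by ring,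
      show x ^ (2 * n + 1) = (x ^ n) ^ 2 * x by ring,
      show (x ^ 2) ^ (2 * n + 1) = (x ^ n) ^ 4 * x ^ 2 by ring,
      show (x ^ 2) ^ (2 * n + 1 + 1) = (x ^ n) ^ 4 * x ^ 4 by ring]
    generalize x ^ n = N
    field_simp
    ring

lemma summable_norm_thetaSeries {x z : ℂ} (hx : ‖x‖ < 1) (hx0 : x ≠ 0) (hz : z ≠ 0) :
    Summable fun j : ℤ ↦ ‖x ^ (j ^ 2) * z ^ j‖ := by
  have hpi : (Real.pi : ℂ) * Complex.I ≠ 0 := by simp [Real.pi_ne_zero]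
  have h : 0 < (Complex.log x / (Real.pi * Complex.I)).im := by
    rw [div_mul_eq_div_div, Complex.div_I]
    simp only [Complex.neg_im, Complex.mul_im, Complex.I_im, Complex.I_re, mul_one,
      mul_zero, add_zero, Complex.div_ofReal_re, Complex.log_re]
    exact neg_pos.mpr (div_neg_of_neg_of_pos (Real.log_neg (norm_pos_iff.mpr hx0) hx) Real.pi_pos)
  have hs := ((summable_jacobiTheta₂_term_iff (Complex.log z / (2 * (Real.pi * Complex.I)))
    _).mpr h).norm
  refine hs.congr fun j ↦ ?_
  rw [jacobiTheta₂_term, ← Complex.exp_log hx0, ← Complex.exp_log hz, ← Complex.exp_int_mul,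
    ← Complex.exp_int_mul, ← Complex.exp_add, Complex.exp_log hx0, Complex.exp_log hz]
  congr 2
  push_cast
  field_simp
  ring

lemma tendsto_qPoch {y : ℂ} (hy : ‖y‖ < 1) :
    Tendsto (fun n : ℕ ↦ ∏ k ∈ Finset.range n, (1 - y ^ (k + 1))) atTop (𝓝 (qPochInf y y)) := by
  simpa [pow_succ'] using (hasProd_qPochInf y hy).tendsto_prod_nat

lemma tendsto_invQPoch {y : ℂ} (hy : ‖y‖ < 1) :
    Tendsto (invQPoch y) atTop (𝓝 (qPochInf y y)⁻¹) := by
  have h := ((tendsto_qPoch hy).inv₀ (qPochInf_ne_zero hy hy)).comp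
    (tendsto_atTop.mpr fun b ↦ (eventually_ge_atTop (b : ℤ)).mono fun m hm ↦ Int.le_toNat
      (by omega) |>.mpr hm : Tendsto Int.toNat atTop atTop)
  refine h.congr' ?_
  filter_upwards [eventually_ge_atTop (0 : ℤ)] with m hm
  simp [invQPoch, not_lt.mpr hm]

lemma exists_norm_invQPoch_le {y : ℂ} (hy : ‖y‖ < 1) : ∃ C, ∀ m, ‖invQPoch y m‖ ≤ C := by
  obtain ⟨C, hC⟩ := ((tendsto_qPoch hy).inv₀ (qPochInf_ne_zero hy hy)).norm.bddAbove_range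
  refine ⟨C, fun m ↦ ?_⟩
  have h0 : 0 ≤ C := (norm_nonneg _).trans (hC ⟨0, rfl⟩)
  by_cases hm : m < 0
  · simpa [invQPoch, hm] using h0
  · simpa [invQPoch, hm] using hC ⟨m.toNat, rfl⟩

/-- **Jacobi's triple product identity**. -/
theorem thetaSeries_eq_prod {x z : ℂ} (hx : ‖x‖ < 1) (hx0 : x ≠ 0) (hz : z ≠ 0) :
    thetaSeries x z =
      qPochInf (x ^ 2) (x ^ 2) * qPochInf (-(x * z)) (x ^ 2) * qPochInf (-(x * z⁻¹)) (x ^ 2) := by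
  have hy := norm_pow_lt_one hx two_ne_zero
  have hP := qPochInf_ne_zero hy hy
  obtain ⟨C, hC⟩ := exists_norm_invQPoch_le hy
  obtain ⟨D, hD⟩ := (tendsto_qPoch hy).norm.bddAbove_range
  have hC0 : 0 ≤ C := (norm_nonneg _).trans (hC 0)
  have h2 : Tendsto (fun n : ℕ ↦ 2 * n) atTop atTop :=
    tendsto_id.const_mul_atTop' two_pos
  have key := tendsto_tsum_of_dominated_convergence (𝓕 := atTop)
    (f := fun (n : ℕ) (j : ℤ) ↦ (∏ k ∈ Finset.range (2 * n), (1 - (x ^ 2) ^ (k + 1))) *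
        (invQPoch (x ^ 2) (n + j) * invQPoch (x ^ 2) (n - j)) * (x ^ (j ^ 2) * z ^ j))
    (g := fun j ↦ (qPochInf (x ^ 2) (x ^ 2))⁻¹ * (x ^ (j ^ 2) * z ^ j))
    ((summable_norm_thetaSeries hx hx0 hz).mul_left (D * (C * C))) (fun j ↦ ?_)
    (Eventually.of_forall fun n j ↦ ?_)
  · simp only [(hasSum_finite_triple_product hx hx0 hz _).tsum_eq, Finset.prod_mul_distrib] at key
    have hprod := ((hasProd_qPochInf (-(x * z)) hy).tendsto_prod_nat).mul
      ((hasProd_qPochInf (-(x * z⁻¹)) hy).tendsto_prod_nat)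
    rw [tsum_mul_left] at key
    have := tendsto_nhds_unique key (hprod.congr fun n ↦ ?_)
    · rw [thetaSeries, mul_assoc, ← this, mul_inv_cancel_left₀ hP]
    · congr 1 <;> exact Finset.prod_congr rfl fun k _ ↦ by ring
  · refine Tendsto.mul_const _ ?_
    have ha : Tendsto (fun n : ℕ ↦ (n : ℤ) + j) atTop atTop :=
      tendsto_atTop_add_const_right _ _ tendsto_natCast_atTop_atTop
    have hb : Tendsto (fun n : ℕ ↦ (n : ℤ) - j) atTop atTop :=
      tendsto_atTop_add_const_right _ (-j) tendsto_natCast_atTop_atTop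
    have := ((tendsto_qPoch hy).comp h2).mul
      (((tendsto_invQPoch hy).comp ha).mul ((tendsto_invQPoch hy).comp hb))
    rwa [mul_inv_cancel_left₀ hP] at this
  · rw [norm_mul, norm_mul, norm_mul]
    gcongr
    · exact (norm_nonneg _).trans (hD ⟨0, rfl⟩)
    · exact hD ⟨2 * n, rfl⟩
    · exact hC _
    · exact hC _

/-- Pairs of integers, split according to the parity of the sum of the coordinates. -/
def intProdParityEquiv : (ℤ × ℤ) ⊕ (ℤ × ℤ) ≃ ℤ × ℤ where
  toFun := Sum.elim (fun p ↦ (p.1 + p.2, p.1 - p.2)) (fun p ↦ (p.1 + p.2 + 1, p.1 - p.2))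
  invFun p := if (p.1 + p.2) % 2 = 0 then .inl ((p.1 + p.2) / 2, (p.1 - p.2) / 2)
    else .inr ((p.1 + p.2 - 1) / 2, (p.1 - p.2 - 1) / 2)
  left_inv := by
    rintro (⟨i, j⟩ | ⟨i, j⟩)
    · have h : (i + j + (i - j)) % 2 = 0 := by omega
      simp only [Sum.elim_inl, h, if_true, Sum.inl.injEq, Prod.mk.injEq]
      omega
    · have h : ¬ (i + j + 1 + (i - j)) % 2 = 0 := by omega
      simp only [Sum.elim_inr, h, if_false, Sum.inr.injEq, Prod.mk.injEq]
      omega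
  right_inv := by
    rintro ⟨m, n⟩
    by_cases h : (m + n) % 2 = 0
    · simp only [h, if_true, Sum.elim_inl, Prod.mk.injEq]
      omega
    · simp only [h, if_false, Sum.elim_inr, Prod.mk.injEq]
      omega

/-- The product of two theta series with the same nome. -/
lemma thetaSeries_mul {x z w : ℂ} (hx : ‖x‖ < 1) (hx0 : x ≠ 0) (hz : z ≠ 0) (hw : w ≠ 0) :
    thetaSeries x z * thetaSeries x w =
      thetaSeries (x ^ 2) (z * w) * thetaSeries (x ^ 2) (z * w⁻¹) +
        x * z * (thetaSeries (x ^ 2) (x ^ 2 * (z * w)) *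
          thetaSeries (x ^ 2) (x ^ 2 * (z * w⁻¹))) := by
  have hy := norm_pow_lt_one hx two_ne_zero
  have hy0 : x ^ 2 ≠ 0 := pow_ne_zero _ hx0
  have hz0 : z * w ≠ 0 := mul_ne_zero hz hw
  have hw0 : z * w⁻¹ ≠ 0 := mul_ne_zero hz (inv_ne_zero hw)
  have s := fun {u : ℂ} (hu : u ≠ 0) ↦ summable_norm_thetaSeries hx hx0 hu
  have s2 := fun {u : ℂ} (hu : u ≠ 0) ↦ summable_norm_thetaSeries hy hy0 hu
  have hX : ∀ m : ℤ, (x ^ 2) ^ m = x ^ (2 * m) := fun m ↦ by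
    rw [zpow_mul]; norm_cast
  have sum := summable_mul_of_summable_norm (s hz) (s hw)
  simp only [thetaSeries]
  rw [tsum_mul_tsum_of_summable_norm (s hz) (s hw),
    tsum_mul_tsum_of_summable_norm (s2 hz0) (s2 hw0),
    tsum_mul_tsum_of_summable_norm (s2 (mul_ne_zero hy0 hz0)) (s2 (mul_ne_zero hy0 hw0)),
    ← intProdParityEquiv.tsum_eq, Summable.tsum_sum, ← tsum_mul_left]
  · congr 1
    · refine tsum_congr fun ⟨i, j⟩ ↦ ?_
      simp only [intProdParityEquiv, Equiv.coe_fn_mk, Sum.elim_inl]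
      rw [hX, hX, mul_zpow, mul_zpow, inv_zpow, zpow_add₀ hz, zpow_sub₀ hw,
        show 2 * i ^ 2 = (i + j) ^ 2 + (i - j) ^ 2 - 2 * j ^ 2 by ring, zpow_sub₀ hx0,
        zpow_add₀ hx0]
      have := zpow_ne_zero (2 * j ^ 2) hx0
      field_simp
    · refine tsum_congr fun ⟨i, j⟩ ↦ ?_
      simp only [intProdParityEquiv, Equiv.coe_fn_mk, Sum.elim_inr]
      simp only [hX, mul_zpow, inv_zpow]
      rw [zpow_add₀ hz, zpow_add₀ hz, zpow_sub₀ hw, zpow_one,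
        show 2 * i ^ 2 = (i + j + 1) ^ 2 + (i - j) ^ 2 - 2 * j ^ 2 - 2 * i - 2 * j - 1 by ring]
      simp only [zpow_sub₀ hx0, zpow_add₀ hx0 ((i + j + 1) ^ 2), zpow_one]
      have h1 := zpow_ne_zero (2 * j ^ 2) hx0
      have h2 := zpow_ne_zero (2 * j) hx0
      have h3 := zpow_ne_zero (2 * i) hx0
      field_simp
  · exact (intProdParityEquiv.summable_iff.mpr sum).comp_injective Sum.inl_injective
  · exact (intProdParityEquiv.summable_iff.mpr sum).comp_injective Sum.inr_injective

/-- A product relation between theta series of nomes `q`, `q²` and `q⁴`. -/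
lemma two_mul_thetaSeries_mul {q : ℂ} (hq : ‖q‖ < 1) (hq0 : q ≠ 0) :
    2 * thetaSeries (q ^ 4) (-q⁻¹) * thetaSeries (q ^ 4) (-q ^ 3) * thetaSeries q 1 =
      thetaSeries (q ^ 2) q⁻¹ * thetaSeries (q ^ 2) (-1) * thetaSeries (q ^ 2) (q ^ 2) := by
  have n2 := norm_pow_lt_one hq two_ne_zero
  have n4 := norm_pow_lt_one hq four_ne_zero
  have i0 : -q⁻¹ ≠ 0 := neg_ne_zero.mpr (inv_ne_zero hq0)
  rw [thetaSeries_eq_prod n4 (pow_ne_zero _ hq0) i0,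
    thetaSeries_eq_prod n4 (pow_ne_zero _ hq0) (neg_ne_zero.mpr (pow_ne_zero _ hq0)),
    thetaSeries_eq_prod hq hq0 one_ne_zero,
    thetaSeries_eq_prod n2 (pow_ne_zero _ hq0) (inv_ne_zero hq0),
    thetaSeries_eq_prod n2 (pow_ne_zero _ hq0) (by simp : (-1 : ℂ) ≠ 0),
    thetaSeries_eq_prod n2 (pow_ne_zero _ hq0) (pow_ne_zero _ hq0)]
  have r1 := qPochInf_split q n2
  have r2 := qPochInf_split q n4
  have r3 := qPochInf_split (q * q ^ 2) n4
  have r4 := qPochInf_split (-q) n2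
  have r5 := qPochInf_mul_neg q n2
  have r6 := qPochInf_mul_neg (q ^ 4) n4
  have r7 := qPochInf_split (q ^ 2) n2
  have r8 := qPochInf_eq_mul (-1) n4
  have e1 : -(q ^ 4 * -q⁻¹) = q ^ 3 := by field_simp
  have e2 : -(q ^ 4 * (-q⁻¹)⁻¹) = q ^ 5 := by field_simp
  have e3 : -(q ^ 4 * -q ^ 3) = q ^ 7 := by ring
  have e4 : -(q ^ 4 * (-q ^ 3)⁻¹) = q := by field_simp
  have e5 : -(q ^ 2 * q⁻¹) = -q := by field_simp
  have e6 : -(q ^ 2 * q⁻¹⁻¹) = -q ^ 3 := by field_simp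
  have e7 : -(q ^ 2 * (q ^ 2)⁻¹) = -1 := by field_simp
  rw [e1, e2, e3, e4, e5, e6, e7]
  norm_num [← pow_mul, ← pow_add, ← pow_succ'] at r1 r2 r3 r4 r5 r6 r7 r8 ⊢
  rw [r8, r7, ← r5, ← r6, r4, r1, r2, r3]
  ring

lemma tprod_sq_one_sub_div_one_add {q : ℂ} (hq : ‖q‖ < 1) :
    ∏' n : ℕ, ((1 - q * (q ^ 2) ^ n) / (1 + q * (q ^ 2) ^ n)) ^ 2 =
      (qPochInf q (q ^ 2) / qPochInf (-q) (q ^ 2)) ^ 2 := by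
  have hy := norm_pow_lt_one hq two_ne_zero
  have h := (hasProd_qPochInf q hy).div₀ (hasProd_qPochInf (-q) hy)
    (qPochInf_ne_zero hy (by simpa using hq))
  simpa [sub_eq_add_neg] using (h.pow 2).tprod_eq

lemma hasProd_one_sub_pow_chi8 {q : ℂ} (hq : ‖q‖ < 1) :
    HasProd (fun n : ℕ ↦ (1 - q ^ (n + 1)) ^ chi8 (n + 1))
      (qPochInf q (q ^ 8) * (qPochInf (q ^ 5) (q ^ 8))⁻¹ *
        ((qPochInf (q ^ 3) (q ^ 8))⁻¹ * qPochInf (q ^ 7) (q ^ 8))) := by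
  have hy := norm_pow_lt_one hq (show 8 ≠ 0 by norm_num)
  have hinv : ∀ {k : ℕ}, k ≠ 0 → HasProd (fun n : ℕ ↦ (1 - q ^ k * (q ^ 8) ^ n) ^ (-1 : ℤ))
      (qPochInf (q ^ k) (q ^ 8))⁻¹ := fun hk ↦ by
    simpa using (hasProd_qPochInf (q ^ _) hy).inv₀
      (qPochInf_ne_zero hy (norm_pow_lt_one hq hk))
  rw [← mul_one (_ * _)]
  refine HasProd.even_mul_odd (.even_mul_odd (.even_mul_odd ?_ ?_) (.even_mul_odd ?_ ?_)) ?_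
  · convert hasProd_qPochInf q hy using 2 with n
    rw [show chi8 (2 * (2 * (2 * n)) + 1) = 1 by simp only [chi8]; split_ifs <;> omega,
      zpow_one]
    ring
  · convert hinv (k := 5) (by norm_num) using 2 with n
    rw [show chi8 (2 * (2 * (2 * n + 1)) + 1) = -1 by simp only [chi8]; split_ifs <;> omega]
    congr 2
    ring
  · convert hinv (k := 3) (by norm_num) using 2 with n
    rw [show chi8 (2 * (2 * (2 * n) + 1) + 1) = -1 by simp only [chi8]; split_ifs <;> omega]
    congr 2
    ring
  · convert hasProd_qPochInf (q ^ 7) hy using 2 with n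
    rw [show chi8 (2 * (2 * (2 * n + 1) + 1) + 1) = 1 by simp only [chi8]; split_ifs <;> omega,
      zpow_one]
    ring
  · convert hasProd_one using 2 with n
    rw [show chi8 (2 * n + 1 + 1) = 0 by simp only [chi8]; split_ifs <;> omega, zpow_zero]

lemma norm_qpow_one_lt_one {τ : ℂ} (hτ : 0 < τ.im) : ‖qpow τ 1‖ < 1 := by
  rw [qpow, Complex.norm_exp, Real.exp_lt_one_iff]
  simpa using mul_pos Real.two_pi_pos hτ

lemma qpow_natCast (τ : ℂ) (n : ℕ) : qpow τ n = qpow τ 1 ^ n := by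
  rw [qpow, qpow, ← Complex.exp_nat_mul]
  congr 1
  push_cast
  ring

lemma vRam_sq {τ : ℂ} (hτ : 0 < τ.im) :
    vRam τ ^ 2 = qpow τ 1 * (thetaSeries (qpow τ 1 ^ 4) (-qpow τ 1 ^ 3) /
      thetaSeries (qpow τ 1 ^ 4) (-(qpow τ 1)⁻¹)) ^ 2 := by
  have hq := norm_qpow_one_lt_one hτ
  have hq0 : qpow τ 1 ≠ 0 := Complex.exp_ne_zero _
  have half : qpow τ (1 / 2) ^ 2 = qpow τ 1 := by
    rw [qpow, qpow, ← Complex.exp_nat_mul]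
    congr 1
    push_cast
    ring
  have hprod : ∏' n : ℕ, (1 - qpow τ ((n : ℝ) + 1)) ^ chi8 (n + 1) =
      ∏' n : ℕ, (1 - qpow τ 1 ^ (n + 1)) ^ chi8 (n + 1) :=
    tprod_congr fun n ↦ by rw [← qpow_natCast]; push_cast; rfl
  rw [vRam, mul_pow, half, hprod, (hasProd_one_sub_pow_chi8 hq).tprod_eq]
  generalize qpow τ 1 = q at *
  have n4 := norm_pow_lt_one hq four_ne_zero
  have n8 := norm_pow_lt_one hq (show 8 ≠ 0 by norm_num)
  have h8 := qPochInf_ne_zero n8 n8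
  rw [thetaSeries_eq_prod n4 (pow_ne_zero _ hq0) (neg_ne_zero.mpr (inv_ne_zero hq0)),
    thetaSeries_eq_prod n4 (pow_ne_zero _ hq0) (neg_ne_zero.mpr (pow_ne_zero _ hq0)),
    show -(q ^ 4 * -q⁻¹) = q ^ 3 by field_simp, show -(q ^ 4 * (-q⁻¹)⁻¹) = q ^ 5 by field_simp,
    show -(q ^ 4 * -q ^ 3) = q ^ 7 by ring, show -(q ^ 4 * (-q ^ 3)⁻¹) = q by field_simp,
    show (q ^ 4) ^ 2 = q ^ 8 by ring]
  have h3 := qPochInf_ne_zero n8 (norm_pow_lt_one hq (show 3 ≠ 0 by norm_num))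
  have h5 := qPochInf_ne_zero n8 (norm_pow_lt_one hq (show 5 ≠ 0 by norm_num))
  field_simp

lemma bWeb_four_mul {τ : ℂ} (hτ : 0 < τ.im) :
    bWeb (4 * τ) = 2 * (thetaSeries (qpow τ 1) (-1) / thetaSeries (qpow τ 1) 1) := by
  have hq := norm_qpow_one_lt_one hτ
  have hq0 : qpow τ 1 ≠ 0 := Complex.exp_ne_zero _
  have hpow : ∀ n : ℕ, qpow (4 * τ) (((n : ℝ) + 1) / 2 - 1 / 4) =
      qpow τ 1 * (qpow τ 1 ^ 2) ^ n := fun n ↦ by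
    rw [← pow_mul, ← pow_succ', ← qpow_natCast, qpow, qpow]
    congr 1
    push_cast
    ring
  simp only [bWeb, hpow]
  generalize qpow τ 1 = q at *
  have n2 := norm_pow_lt_one hq two_ne_zero
  have h1 := qPochInf_ne_zero n2 n2
  have h2 := qPochInf_ne_zero n2 (a := -q) (by simpa using hq)
  rw [tprod_sq_one_sub_div_one_add hq, thetaSeries_eq_prod hq hq0 (by simp : (-1 : ℂ) ≠ 0),
    thetaSeries_eq_prod hq hq0 one_ne_zero]
  norm_num
  field_simp

/-- If `τ` lies in the upper half-plane, then
`(v(τ)² + 1)²·𝔟(4τ)² = 4(v(τ)⁴ - 6v(τ)² + 1)`. -/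
theorem v_b_relation (τ : ℂ) (hτ : 0 < τ.im) :
    (vRam τ ^ 2 + 1) ^ 2 * bWeb (4 * τ) ^ 2 = 4 * (vRam τ ^ 4 - 6 * vRam τ ^ 2 + 1) := by
  have hq := norm_qpow_one_lt_one hτ
  have hq0 : qpow τ 1 ≠ 0 := Complex.exp_ne_zero _
  rw [show vRam τ ^ 4 = (vRam τ ^ 2) ^ 2 by ring, vRam_sq hτ, bWeb_four_mul hτ]
  generalize qpow τ 1 = q at *
  have n2 := norm_pow_lt_one hq two_ne_zero
  have n4 := norm_pow_lt_one hq four_ne_zero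
  have n8 := norm_pow_lt_one hq (show 8 ≠ 0 by norm_num)
  have hA : thetaSeries (q ^ 4) (-q⁻¹) ≠ 0 := by
    rw [thetaSeries_eq_prod n4 (pow_ne_zero _ hq0) (neg_ne_zero.mpr (inv_ne_zero hq0)),
      show -(q ^ 4 * -q⁻¹) = q ^ 3 by field_simp, show -(q ^ 4 * (-q⁻¹)⁻¹) = q ^ 5 by field_simp,
      show (q ^ 4) ^ 2 = q ^ 8 by ring]
    exact mul_ne_zero (mul_ne_zero (qPochInf_ne_zero n8 n8)
      (qPochInf_ne_zero n8 (norm_pow_lt_one hq (by norm_num))))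
      (qPochInf_ne_zero n8 (norm_pow_lt_one hq (by norm_num)))
  have hF : thetaSeries q 1 ≠ 0 := by
    rw [thetaSeries_eq_prod hq hq0 one_ne_zero]
    have h := qPochInf_ne_zero n2 (a := -q) (by simpa using hq)
    simpa using ⟨qPochInf_ne_zero n2 n2, h⟩
  have t1 := thetaSeries_mul n2 (pow_ne_zero 2 hq0) (inv_ne_zero hq0) (by simp : (-1 : ℂ) ≠ 0)
  have t2 := thetaSeries_mul hq hq0 one_ne_zero one_ne_zero
  have t3 := thetaSeries_mul hq hq0 (by simp : (-1 : ℂ) ≠ 0) (by simp : (-1 : ℂ) ≠ 0)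
  have t4 := two_mul_thetaSeries_mul hq hq0
  rw [show (q ^ 2) ^ 2 = q ^ 4 by ring, show q⁻¹ * -1 = -q⁻¹ by ring,
    show q⁻¹ * (-1)⁻¹ = -q⁻¹ by norm_num, show q ^ 4 * -q⁻¹ = -q ^ 3 by field_simp,
    show q ^ 2 * q⁻¹ = q by field_simp] at t1
  norm_num at t2 t3
  rw [t1] at t4
  generalize thetaSeries (q ^ 4) (-q⁻¹) = A at *
  generalize thetaSeries (q ^ 4) (-q ^ 3) = B at *
  generalize thetaSeries q 1 = F at *
  generalize thetaSeries q (-1) = G at *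
  generalize thetaSeries (q ^ 2) (q ^ 2) = H at *
  generalize thetaSeries (q ^ 2) 1 = K at *
  field_simp
  linear_combination (-4 * (A ^ 2 + q * B ^ 2) ^ 2) * (t2 - t3) +
    8 * q * (2 * A * B * F + (A ^ 2 + q * B ^ 2) * H) * t4
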